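/- arXiv:2605.22758 — 2 statements merged into one kernel-verified Lean document; each statement's English description precedes it below -/
import Mathlib

section
/- Let n : ℕ with n ≥ 3 and let i : ℕ satisfy i + 1 < n. Then exactly two edges of the cycle graph SimpleGraph.cycleGraph n cross the cut at i; that is, the number of edges e ∈ (SimpleGraph.cycleGraph n).edgeFinset such that, writing e = s(a, b) with vertices a, b : Fin n, one has min (a : ℕ) (b : ℕ) ≤ i and i < max (a : ℕ) (b : ℕ), equals 2. -/
open scoped Classical

theorem cycleGraph_adj_iff_val {n : ℕ} (hn : 2 ≤ n) (a b : Fin n) :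
    (SimpleGraph.cycleGraph n).Adj a b ↔
      (a : ℕ) + 1 = b ∨ (b : ℕ) + 1 = a ∨
        ((a : ℕ) = 0 ∧ (b : ℕ) + 1 = n) ∨ ((b : ℕ) = 0 ∧ (a : ℕ) + 1 = n) := by
  rw [SimpleGraph.cycleGraph_adj']
  have ha := a.isLt
  have hb := b.isLt
  rcases le_or_gt a b with h | h
  · rcases h.eq_or_lt with rfl | h
    · grind [Fin.coe_sub_iff_le]
    · have := Fin.coe_sub_iff_le.2 h.le
      have := Fin.coe_sub_iff_lt.2 h
      rw [Fin.lt_def] at h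
      omega
  · have := Fin.coe_sub_iff_le.2 h.le
    have := Fin.coe_sub_iff_lt.2 h
    rw [Fin.lt_def] at h
    omega

/-- In the cycle graph on `Fin n` (`n ≥ 3`) with the natural vertex ordering,
each cut `i` (with `i + 1 < n`) is crossed by exactly two edges
(proof of Theorem 4.3). -/
theorem cycleGraph_cut_crossings (n i : ℕ) (hn : 3 ≤ n) (hi : i + 1 < n) :
    ((SimpleGraph.cycleGraph n).edgeFinset.filter
        (fun e => ∃ a b : Fin n, e = s(a, b) ∧
          min (a : ℕ) (b : ℕ) ≤ i ∧ i < max (a : ℕ) (b : ℕ))).card = 2 := by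
  rw [Finset.card_eq_two]
  refine ⟨s(⟨i, by omega⟩, ⟨i + 1, hi⟩), s(⟨0, by omega⟩, ⟨n - 1, by omega⟩), ?_, ?_⟩
  · simp only [ne_eq, Sym2.eq_iff, Fin.mk.injEq]
    omega
  · ext e
    simp only [Finset.mem_filter, SimpleGraph.mem_edgeFinset, Finset.mem_insert,
      Finset.mem_singleton]
    constructor
    · rintro ⟨he, a, b, rfl, hcross⟩
      rw [SimpleGraph.mem_edgeSet, cycleGraph_adj_iff_val (by omega)] at he
      simp only [Sym2.eq_iff, Fin.ext_iff]
      omega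
    · rintro (rfl | rfl)
      all_goals rw [SimpleGraph.mem_edgeSet, cycleGraph_adj_iff_val (by omega)]
      · exact ⟨Or.inl rfl, _, _, rfl, by simp⟩
      · refine ⟨Or.inr (Or.inr (Or.inl ⟨rfl, ?_⟩)), _, _, rfl, ?_⟩
        · simp only
          omega
        · simp only
          omega
end

section
/- There exist functions f : Bool → Bool → ℤ and g : Bool → ℤ such that: (i) f is monotone in each argument and g is monotone (with respect to the order false ≤ true on Bool and the usual order on ℤ); (ii) f false false = 0, and f and g take only nonnegative values; (iii) Complex.exp (-(Complex.I) * (π/4 : ℂ) * (f false false : ℂ)) = 1, Complex.exp (-(Complex.I) * (π/4 : ℂ) * (f false true : ℂ)) = Complex.I, Complex.exp (-(Complex.I) * (π/4 : ℂ) * (f true false : ℂ)) = 1, Complex.exp (-(Complex.I) * (π/4 : ℂ) * (f true true : ℂ)) = -Complex.I; and (iv) Complex.exp (-(Complex.I) * (π/4 : ℂ) * (g false : ℂ)) = Complex.exp (Complex.I * (π/4 : ℂ)) and Complex.exp (-(Complex.I) * (π/4 : ℂ) * (g true : ℂ)) = Complex.exp (-(Complex.I) * (π/4 : ℂ)). 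-/
open Real

/-- The phase `exp (-i (π / 4) c)` depends only on the integer `c` modulo `8`. -/
theorem exp_neg_I_mul_pi_div_four_congr {c d : ℤ} (h : c ≡ d [ZMOD 8]) :
    Complex.exp (-(Complex.I) * ((π / 4 : ℝ) : ℂ) * (c : ℂ)) =
      Complex.exp (-(Complex.I) * ((π / 4 : ℝ) : ℂ) * (d : ℂ)) := by
  obtain ⟨k, hk⟩ := h.dvd
  obtain rfl : d = c + 8 * k := by lia
  refine Complex.exp_eq_exp_iff_exists_int.2 ⟨k, ?_⟩
  push_cast
  ring

/-- Core of Proposition 3.5: the diagonal phases of the coupling gate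
`W = diag(1, i, 1, -i)` and of the endpoint gate `e^{iπZ/4}` can be realized
by monotone nonnegative integer cost terms. -/
theorem monotone_cost_terms :
    ∃ (f : Bool → Bool → ℤ) (g : Bool → ℤ),
      (∀ a : Bool, Monotone (f a)) ∧
      (∀ b : Bool, Monotone (fun a => f a b)) ∧
      Monotone g ∧
      f false false = 0 ∧
      (∀ a b : Bool, 0 ≤ f a b) ∧
      (∀ a : Bool, 0 ≤ g a) ∧
      Complex.exp (-(Complex.I) * ((π / 4 : ℝ) : ℂ) * ((f false false : ℤ) : ℂ)) = 1 ∧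
      Complex.exp (-(Complex.I) * ((π / 4 : ℝ) : ℂ) * ((f false true : ℤ) : ℂ)) = Complex.I ∧
      Complex.exp (-(Complex.I) * ((π / 4 : ℝ) : ℂ) * ((f true false : ℤ) : ℂ)) = 1 ∧
      Complex.exp (-(Complex.I) * ((π / 4 : ℝ) : ℂ) * ((f true true : ℤ) : ℂ)) = -Complex.I ∧
      Complex.exp (-(Complex.I) * ((π / 4 : ℝ) : ℂ) * ((g false : ℤ) : ℂ)) =
        Complex.exp (Complex.I * ((π / 4 : ℝ) : ℂ)) ∧
      Complex.exp (-(Complex.I) * ((π / 4 : ℝ) : ℂ) * ((g true : ℤ) : ℂ)) =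
        Complex.exp (-(Complex.I) * ((π / 4 : ℝ) : ℂ)) := by
  refine ⟨fun a b => bif b then (bif a then 10 else 6) else 0, fun b => bif b then 9 else 7,
    by decide, by decide, by decide, rfl, by decide, by decide, ?_, ?_, ?_, ?_, ?_, ?_⟩ <;>
    simp only [cond_true, cond_false]
  · simp
  · rw [exp_neg_I_mul_pi_div_four_congr (d := -2) (by decide)]
    refine Eq.trans (congrArg Complex.exp ?_) Complex.exp_pi_div_two_mul_I
    push_cast
    ring
  · simp
  · rw [exp_neg_I_mul_pi_div_four_congr (d := 2) (by decide)]
    refine Eq.trans (congrArg Complex.exp ?_) Complex.exp_neg_pi_div_two_mul_I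
    push_cast
    ring
  · rw [exp_neg_I_mul_pi_div_four_congr (d := -1) (by decide)]
    congr 1
    push_cast
    ring
  · rw [exp_neg_I_mul_pi_div_four_congr (d := 1) (by decide), Int.cast_one, mul_one]
end
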